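/- A trapezoidal word w over {a,b} is left special (i.e., both aw and bw are trapezoidal) if and only if either (1) w is a prefix of some central word, or (2) w = u·x·y·u·y·q for some central word u, distinct letters x,y with {x,y} = {a,b}, and a word q such that π_{yuyq} = π_{yu}. -/

import Mathlib

/-- The two-letter alphabet {a, b}. -/
inductive AB : Type
  | a : AB
  | b : AB
deriving DecidableEq, Repr

/-- A (finite) word over {a, b}. -/
abbrev Word := List AB

open AB

/-- `u` occurs in `w` at position `i`. -/
def OccursAt (u w : Word) (i : ℕ) : Prop :=
  i + u.length ≤ w.length ∧ (w.drop i).take u.length = u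

/-- `u` occurs exactly once in `w` (is unrepeated in `w`). -/
def OccursOnce (u w : Word) : Prop := ∃! i, OccursAt u w i

/-- `u` is a right special factor of `w`: both `ua` and `ub` are factors of `w`. -/
def IsRightSpecial (u w : Word) : Prop := (u ++ [a]) <:+: w ∧ (u ++ [b]) <:+: w

/-- `u` is a left special factor of `w`: both `au` and `bu` are factors of `w`. -/
def IsLeftSpecial (u w : Word) : Prop := ([a] ++ u) <:+: w ∧ ([b] ++ u) <:+: w

/-- `K w`: the length of the shortest unrepeated suffix of `w`. -/
noncomputable def Kp (w : Word) : ℕ := sInf {n | ∃ s : Word, s <:+ w ∧ s.length = n ∧ OccursOnce s w}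

/-- `H w`: the length of the shortest unrepeated prefix of `w`. -/
noncomputable def Hp (w : Word) : ℕ := sInf {n | ∃ p : Word, p <+: w ∧ p.length = n ∧ OccursOnce p w}

/-- `R w`: the smallest `n ≥ 0` such that `w` has no right special factor of length `n`. -/
noncomputable def Rp (w : Word) : ℕ := sInf {n | ∀ u : Word, u.length = n → ¬ IsRightSpecial u w}

/-- `L w`: the smallest `n ≥ 0` such that `w` has no left special factor of length `n`. -/
noncomputable def Lp (w : Word) : ℕ := sInf {n | ∀ u : Word, u.length = n → ¬ IsLeftSpecial u w}

/-- A word `w` is trapezoidal if `|w| = K w + R w`. -/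
def IsTrapezoidal (w : Word) : Prop := w.length = Kp w + Rp w

/-- A finite word over `{a,b}` is Sturmian iff it is balanced: there is no word `u`
with both `aua` and `bub` factors of `w`. -/
def IsSturmian (w : Word) : Prop :=
  ¬ ∃ u : Word, ([a] ++ u ++ [a]) <:+: w ∧ ([b] ++ u ++ [b]) <:+: w

/-- A nonempty word is closed if it has a border (a proper prefix which is also a suffix)
whose only occurrences in `w` are as a prefix and as a suffix. -/
def IsClosedWord (w : Word) : Prop :=
  w ≠ [] ∧ ∃ v : Word, v <+: w ∧ v.length < w.length ∧ v <:+ w ∧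
    ∀ i : ℕ, OccursAt v w i → i = 0 ∨ i + v.length = w.length

/-- A nonempty word is open if it is not closed. -/
def IsOpenWord (w : Word) : Prop := w ≠ [] ∧ ¬ IsClosedWord w

/-- Central words: `a^n`, `b^n`, or `u a b v = v b a u`. -/
def IsCentral (w : Word) : Prop :=
  (∃ n : ℕ, w = List.replicate n a) ∨ (∃ n : ℕ, w = List.replicate n b) ∨
  (∃ u v : Word, w = u ++ [a, b] ++ v ∧ w = v ++ [b, a] ++ u)

/-- The minimal period of `w`: `|w|` minus the length of the longest border of `w`. -/
noncomputable def minPeriod (w : Word) : ℕ :=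
  w.length - sSup {n | ∃ v : Word, v.length = n ∧ v <+: w ∧ v ≠ w ∧ v <:+ w}


/-- `w` has no strong bispecial factor: for no word `f` are all four words `cfd` factors of `w`. -/
def NoStrongBispecial (w : Word) : Prop :=
  ∀ f : Word, ¬ ∀ c d : AB, c :: (f ++ [d]) <:+: w

theorem AB.eq_of_ne_of_ne {c d z : AB} (hc : c ≠ z) (hd : d ≠ z) : c = d := by
  cases c <;> cases d <;> cases z <;> simp_all

theorem isRightSpecial_iff {u w : Word} :
    IsRightSpecial u w ↔ ∀ c, u ++ [c] <:+: w :=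
  ⟨fun h c => by cases c; exacts [h.1, h.2], fun h => ⟨h _, h _⟩⟩

theorem occursAt_iff {u w : Word} {i : ℕ} :
    OccursAt u w i ↔ ∃ l r, l.length = i ∧ w = l ++ u ++ r := by
  constructor
  · rintro ⟨h, hu⟩
    refine ⟨w.take i, (w.drop i).drop u.length, by simp; omega, ?_⟩
    conv_rhs => rw [← hu]
    simp only [List.append_assoc]
    rw [show ((w.drop i).take u.length).length = u.length by simp; omega]
    simp
  · rintro ⟨l, r, rfl, rfl⟩
    simp [OccursAt]

theorem occursOnce_iff_of_suffix {s w : Word} (hs : s <:+ w) :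
    OccursOnce s w ↔ ∀ c, ¬ s ++ [c] <:+: w := by
  obtain ⟨p, rfl⟩ := hs
  have hp : OccursAt s (p ++ s) p.length := occursAt_iff.2 ⟨p, [], rfl, by simp⟩
  constructor
  · rintro h c ⟨l, r, hlr⟩
    have h1 : OccursAt s (p ++ s) l.length :=
      occursAt_iff.2 ⟨l, c :: r, rfl, by simp [← hlr]⟩
    have h2 := h.unique hp h1
    have h3 := congrArg List.length hlr
    simp at h3
    omega
  · intro h
    refine ⟨_, hp, fun i hi => ?_⟩
    obtain ⟨l, r, rfl, hlr⟩ := occursAt_iff.1 hi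
    cases r with
    | nil =>
      have h3 := congrArg List.length hlr
      simp at h3
      omega
    | cons c r => exact absurd ⟨l, r, by simp [hlr]⟩ (h c)

theorem lt_Kp_iff {s w : Word} (hs : s <:+ w) :
    s.length < Kp w ↔ ∃ c, s ++ [c] <:+: w := by
  constructor
  · intro h
    by_contra! hc
    exact Nat.notMem_of_lt_sInf h ⟨s, hs, rfl, (occursOnce_iff_of_suffix hs).2 hc⟩
  · rintro ⟨c, hc⟩
    by_contra! h
    have hne : {n | ∃ s : Word, s <:+ w ∧ s.length = n ∧ OccursOnce s w}.Nonempty := by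
      refine ⟨_, w, List.suffix_rfl, rfl, (occursOnce_iff_of_suffix List.suffix_rfl).2 ?_⟩
      intro c hc
      have := hc.length_le
      simp at this
    obtain ⟨t, ht, htl, hto⟩ := Nat.sInf_mem hne
    change t.length = Kp w at htl
    obtain ⟨p, rfl⟩ := List.suffix_of_suffix_length_le ht hs (by omega)
    refine (occursOnce_iff_of_suffix ht).1 hto c (List.IsInfix.trans ⟨p, [], ?_⟩ hc)
    simp

theorem Kp_le_length (w : Word) : Kp w ≤ w.length := by
  by_contra! h
  obtain ⟨c, hc⟩ := (lt_Kp_iff (List.suffix_refl w)).1 h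
  have := hc.length_le
  simp at this

theorem concat_infix_concat_iff {u w : Word} {c d : AB} :
    u ++ [d] <:+: w ++ [c] ↔ u ++ [d] <:+: w ∨ (d = c ∧ u <:+ w) := by
  rw [List.infix_concat_iff]
  constructor
  · rintro (⟨p, h⟩ | h)
    · rw [← List.append_assoc] at h
      obtain ⟨h1, h2⟩ := List.append_inj' h rfl
      exact Or.inr ⟨by simpa using h2, p, h1⟩
    · exact Or.inl h
  · rintro (h | ⟨rfl, p, rfl⟩)
    · exact Or.inr h
    · exact Or.inl ⟨p, by simp⟩

theorem exists_concat_infix_concat {u w : Word} (c : AB) (h : u <:+: w) :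
    ∃ d, u ++ [d] <:+: w ++ [c] := by
  obtain ⟨l, r, rfl⟩ := h
  cases r with
  | nil => exact ⟨c, l, [], by simp⟩
  | cons d r => exact ⟨d, l, r ++ [c], by simp⟩

/-- The set of right special factors of `w`. -/
def rightSpecials (w : Word) : Set Word := {u | IsRightSpecial u w}

theorem finite_rightSpecials (w : Word) : (rightSpecials w).Finite := by
  refine (w.sublists.toFinset.finite_toSet).subset fun u hu => ?_
  have h : u <:+: w := List.IsInfix.trans ⟨[], [a], by simp⟩ hu.1
  simpa using h.sublist

theorem Kp_concat_le_iff {u w : Word} {c : AB} (hu : u <:+ w) :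
    Kp (w ++ [c]) ≤ u.length + 1 ↔ ¬ u ++ [c] <:+: w := by
  have hs : u ++ [c] <:+ w ++ [c] := by
    obtain ⟨p, rfl⟩ := hu
    exact ⟨p, by simp⟩
  rw [← not_lt, not_iff_not, ← show (u ++ [c]).length = u.length + 1 by simp, lt_Kp_iff hs]
  constructor
  · rintro ⟨d, hd⟩
    rcases concat_infix_concat_iff.1 hd with h | ⟨-, h⟩
    · exact List.IsInfix.trans ⟨[], [d], by simp⟩ h
    · exact h.isInfix
  · exact exists_concat_infix_concat c

theorem rightSpecials_concat (w : Word) (c : AB) :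
    rightSpecials (w ++ [c]) = rightSpecials w ∪
      (fun n => w.drop (w.length - n)) '' Set.Ico (Kp (w ++ [c]) - 1) (Kp w) := by
  ext u
  have himg : u ∈ (fun n => w.drop (w.length - n)) '' Set.Ico (Kp (w ++ [c]) - 1) (Kp w) ↔
      u <:+ w ∧ (∃ d, u ++ [d] <:+: w) ∧ ¬ u ++ [c] <:+: w := by
    constructor
    · rintro ⟨n, ⟨h1, h2⟩, rfl⟩
      have hs := List.drop_suffix (w.length - n) w
      have := Kp_le_length w
      have hl : (w.drop (w.length - n)).length = n := by simp; omega
      refine ⟨hs, (lt_Kp_iff hs).1 (by omega), (Kp_concat_le_iff hs).1 (by omega)⟩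
    · rintro ⟨hs, h1, h2⟩
      have h1 := (lt_Kp_iff hs).2 h1
      have h2 := (Kp_concat_le_iff hs).2 h2
      exact ⟨u.length, ⟨by omega, h1⟩, (List.suffix_iff_eq_drop.1 hs).symm⟩
  rw [Set.mem_union, himg]
  simp only [rightSpecials, Set.mem_ofPred_eq, isRightSpecial_iff, concat_infix_concat_iff]
  constructor
  · intro h
    by_cases hc : u ++ [c] <:+: w
    · left
      intro d
      rcases h d with h | ⟨rfl, -⟩ <;> assumption
    · right
      refine ⟨(h c).resolve_left hc |>.2, ?_, hc⟩
      by_contra! hn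
      rcases c with _ | _
      · exact absurd ((h b).resolve_left (hn b)).1 (by simp)
      · exact absurd ((h a).resolve_left (hn a)).1 (by simp)
  · rintro (h | ⟨h1, ⟨d, hd⟩, h3⟩) e
    · exact Or.inl (h e)
    · by_cases hec : e = c
      · exact Or.inr ⟨hec, h1⟩
      · have : d ≠ c := by rintro rfl; exact h3 hd
        rw [AB.eq_of_ne_of_ne hec this]
        exact Or.inl hd

theorem ncard_rightSpecials_add_Kp (w : Word) :
    (rightSpecials w).ncard + Kp w = w.length := by
  induction w using List.reverseRecOn with
  | nil =>
    have h : rightSpecials [] = ∅ := by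
      ext u
      simp [rightSpecials, IsRightSpecial]
    have := Kp_le_length []
    simp_all
  | append_singleton w c ih =>
    have hle := Kp_le_length w
    have h1 : Kp (w ++ [c]) ≤ Kp w + 1 := by
      have hs := List.drop_suffix (w.length - Kp w) w
      have hl : (w.drop (w.length - Kp w)).length = Kp w := by simp; omega
      rw [← hl, Kp_concat_le_iff hs]
      intro h
      have := (lt_Kp_iff hs).2 ⟨c, h⟩
      omega
    have h2 : 0 < Kp (w ++ [c]) :=
      (lt_Kp_iff (s := []) List.nil_suffix).2 ⟨c, w, [], by simp⟩
    have hinj : Set.InjOn (fun n => w.drop (w.length - n))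
        (Set.Ico (Kp (w ++ [c]) - 1) (Kp w)) := by
      intro m hm n hn h
      have := congrArg List.length h
      simp only [Set.mem_Ico, List.length_drop] at *
      omega
    have hdisj : Disjoint (rightSpecials w)
        ((fun n => w.drop (w.length - n)) '' Set.Ico (Kp (w ++ [c]) - 1) (Kp w)) := by
      rw [Set.disjoint_left]
      rintro u hu ⟨n, ⟨hn1, hn2⟩, rfl⟩
      have hs := List.drop_suffix (w.length - n) w
      refine (Kp_concat_le_iff (c := c) hs).1 ?_ (isRightSpecial_iff.1 hu c)
      simp only [List.length_drop]
      omega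
    rw [rightSpecials_concat, Set.ncard_union_eq hdisj (finite_rightSpecials w)
      ((Set.finite_Ico _ _).image _), hinj.ncard_image]
    simp [Set.ncard_eq_toFinset_card']
    omega

theorem IsRightSpecial.of_suffix {u v w : Word} (hv : IsRightSpecial v w) (h : u <:+ v) :
    IsRightSpecial u w := by
  obtain ⟨p, rfl⟩ := h
  exact ⟨List.IsInfix.trans ⟨p, [], by simp⟩ hv.1, List.IsInfix.trans ⟨p, [], by simp⟩ hv.2⟩

theorem image_length_rightSpecials (w : Word) :
    List.length '' rightSpecials w = Set.Iio (Rp w) := by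
  have hne : {n | ∀ u : Word, u.length = n → ¬ IsRightSpecial u w}.Nonempty := by
    refine ⟨w.length, fun u hu h => ?_⟩
    have := h.1.length_le
    simp at this
    omega
  ext n
  simp only [Set.mem_image, Set.mem_Iio]
  constructor
  · rintro ⟨u, hu, rfl⟩
    by_contra! h
    refine Nat.sInf_mem hne (u.drop (u.length - Rp w)) ?_ (hu.of_suffix (List.drop_suffix _ _))
    change _ = Rp w
    simp
    omega
  · intro h
    have := Nat.notMem_of_lt_sInf h
    simp only [Set.mem_ofPred_eq] at this
    push Not at this
    obtain ⟨u, hl, hu⟩ := this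
    exact ⟨u, hu, hl⟩

theorem noStrongBispecial_iff_injOn (w : Word) :
    NoStrongBispecial w ↔ Set.InjOn List.length (rightSpecials w) := by
  constructor
  · intro hT u
    induction u with
    | nil =>
      intro _ v _ h
      exact (List.length_eq_zero_iff.1 h.symm).symm
    | cons c f ih =>
      intro hu v hv h
      cases v with
      | nil => simp at h
      | cons d g =>
        have hfg : f = g := ih (hu.of_suffix (List.suffix_cons _ _))
          (hv.of_suffix (List.suffix_cons _ _)) (by simpa using h)
        subst hfg
        by_contra hne
        refine hT f fun x y => ?_
        by_cases hx : x = c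
        · subst hx
          exact isRightSpecial_iff.1 hu y
        · have hd : d ≠ c := by rintro rfl; exact hne rfl
          rw [AB.eq_of_ne_of_ne hx hd]
          exact isRightSpecial_iff.1 hv y
  · intro h f hf
    have := h (x₁ := a :: f) (x₂ := b :: f) (isRightSpecial_iff.2 fun d => hf a d)
      (isRightSpecial_iff.2 fun d => hf b d) (by simp)
    simp at this

theorem isTrapezoidal_iff (w : Word) : IsTrapezoidal w ↔ NoStrongBispecial w := by
  have h1 := ncard_rightSpecials_add_Kp w
  have h2 : (List.length '' rightSpecials w).ncard = Rp w := by
    rw [image_length_rightSpecials]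
    simp [Set.ncard_eq_toFinset_card']
  rw [noStrongBispecial_iff_injOn, ← Set.ncard_image_iff (finite_rightSpecials w), h2,
    IsTrapezoidal]
  omega

theorem NoStrongBispecial.of_infix {v w : Word} (hw : NoStrongBispecial w) (h : v <:+: w) :
    NoStrongBispecial v :=
  fun f hf => hw f fun c d => (hf c d).trans h

/-- The elementary Sturmian morphism fixing `z` and sending the other letter `c` to `zc`. -/
def sturm (z : AB) : Word → Word
  | [] => []
  | c :: w => if c = z then z :: sturm z w else z :: c :: sturm z w

@[simp] theorem sturm_nil (z : AB) : sturm z [] = [] := rfl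

@[simp] theorem sturm_cons_self (z : AB) (w : Word) : sturm z (z :: w) = z :: sturm z w := by
  simp [sturm]

theorem sturm_cons_of_ne {c z : AB} (h : c ≠ z) (w : Word) :
    sturm z (c :: w) = z :: c :: sturm z w := by
  simp [sturm, h]

@[simp] theorem sturm_append (z : AB) (v w : Word) :
    sturm z (v ++ w) = sturm z v ++ sturm z w := by
  induction v with
  | nil => simp
  | cons c v ih => by_cases h : c = z <;> simp [sturm, h, ih]

theorem sturm_cons_eq (z c : AB) (w : Word) : ∃ s, sturm z (c :: w) = z :: s := by
  by_cases h : c = z <;> simp [sturm, h]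

theorem sturm_concat_eq (z : AB) (w : Word) (s : Word) :
    ∃ t, sturm z w ++ z :: s = z :: t := by
  cases w with
  | nil => exact ⟨s, rfl⟩
  | cons c w =>
    obtain ⟨t, ht⟩ := sturm_cons_eq z c w
    exact ⟨t ++ z :: s, by simp [ht]⟩

theorem sturm_cons_ends (z c : AB) : ∃ p, sturm z [c] = p ++ [c] := by
  by_cases h : c = z
  · exact ⟨[], by simp [sturm, h]⟩
  · exact ⟨[z], by simp [sturm, h]⟩

theorem sturm_injective (z : AB) : Function.Injective (sturm z) := by
  intro v
  induction v with
  | nil =>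
    intro w h
    cases w with
    | nil => rfl
    | cons d w => obtain ⟨s, hs⟩ := sturm_cons_eq z d w; simp [hs] at h
  | cons c v ih =>
    intro w h
    cases w with
    | nil => obtain ⟨s, hs⟩ := sturm_cons_eq z c v; simp [hs] at h
    | cons d w =>
      by_cases hc : c = z <;> by_cases hd : d = z
      · subst hc; subst hd
        simp at h
        rw [ih h]
      · subst hc
        rw [sturm_cons_self, sturm_cons_of_ne hd] at h
        cases v with
        | nil => simp at h
        | cons e v =>
          obtain ⟨s, hs⟩ := sturm_cons_eq c e v
          simp [hs] at h
          exact absurd h.1.symm hd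
      · subst hd
        rw [sturm_cons_self, sturm_cons_of_ne hc] at h
        cases w with
        | nil => simp at h
        | cons e w =>
          obtain ⟨s, hs⟩ := sturm_cons_eq d e w
          simp [hs] at h
          exact absurd h.1 hc
      · have := AB.eq_of_ne_of_ne hc hd
        subst this
        simp [sturm_cons_of_ne hc] at h
        rw [ih h]

theorem sturm_length_pos {z : AB} {w : Word} (h : w ≠ []) : sturm z w ≠ [] := by
  cases w with
  | nil => exact absurd rfl h
  | cons c w => obtain ⟨s, hs⟩ := sturm_cons_eq z c w; simp [hs]

theorem length_le_length_sturm (z : AB) (w : Word) : w.length ≤ (sturm z w).length := by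
  induction w with
  | nil => simp
  | cons c w ih => by_cases h : c = z <;> simp [sturm, h] <;> omega

/-- Every occurrence of `z` starts a new block of `sturm z X ++ [z]`. -/
theorem exists_split_of_sturm_eq {z : AB} {X p s : Word}
    (h : sturm z X ++ [z] = p ++ z :: s) :
    ∃ X₁ X₂, X = X₁ ++ X₂ ∧ p = sturm z X₁ ∧ z :: s = sturm z X₂ ++ [z] := by
  induction X generalizing p with
  | nil =>
    cases p with
    | nil => exact ⟨[], [], by simpa using h.symm⟩
    | cons c p => simp at h
  | cons c X ih =>
    cases p with
    | nil => exact ⟨[], c :: X, by simpa using h.symm⟩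
    | cons d p =>
      by_cases hc : c = z
      · subst hc
        simp only [sturm_cons_self, List.cons_append, List.cons.injEq] at h
        obtain ⟨X₁, X₂, rfl, rfl, hs⟩ := ih h.2
        exact ⟨c :: X₁, X₂, by simp, by simp [h.1], hs⟩
      · rw [sturm_cons_of_ne hc] at h
        simp only [List.cons_append, List.cons.injEq] at h
        obtain ⟨rfl, h⟩ := h
        cases p with
        | nil =>
          simp at h
          exact absurd h.1 hc
        | cons e p =>
          simp only [List.cons_append, List.cons.injEq] at h
          obtain ⟨rfl, h⟩ := h
          obtain ⟨X₁, X₂, rfl, rfl, hs⟩ := ih h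
          exact ⟨c :: X₁, X₂, by simp, by simp [sturm_cons_of_ne hc], hs⟩

theorem not_square_infix_sturm {y z : AB} (hy : y ≠ z) (X : Word) :
    ¬ [y, y] <:+: sturm z X ++ [z] := by
  induction X with
  | nil =>
    intro h
    have := h.length_le
    simp at this
  | cons c X ih =>
    obtain ⟨t, ht⟩ := sturm_concat_eq z X []
    by_cases hc : c = z
    · subst hc
      intro h
      simp only [sturm_cons_self, List.cons_append, List.infix_cons_iff] at h
      rcases h with h | h
      · simp [hy] at h
      · exact ih h
    · intro h
      rw [sturm_cons_of_ne hc] at h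
      simp only [List.cons_append, List.infix_cons_iff] at h
      rcases h with h | h | h
      · simp [hy] at h
      · rw [ht] at h
        simp [hy] at h
      · exact ih h

/-- A word with no factor `yy` that does not start with `y` is in the image of `sturm z`. -/
theorem exists_eq_sturm {y z : AB} (hy : y ≠ z) :
    ∀ w : Word, w.head? ≠ some y → ¬ [y, y] <:+: w → ∃ v, w = sturm z v
  | [], _, _ => ⟨[], rfl⟩
  | [c], hh, _ => by
    have hc : c ≠ y := by simpa using hh
    have : c = z := AB.eq_of_ne_of_ne hc hy.symm
    exact ⟨[z], by simp [this]⟩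
  | c :: d :: w, hh, hw => by
    have hc : c ≠ y := by simpa using hh
    have hc : c = z := AB.eq_of_ne_of_ne hc hy.symm
    subst hc
    by_cases hd : d = y
    · subst hd
      obtain ⟨v, rfl⟩ := exists_eq_sturm hy w (by
        intro h
        cases w with
        | nil => simp at h
        | cons e w =>
          simp at h
          subst h
          exact hw ⟨[c], w, by simp⟩) (fun h => hw (h.trans ⟨[c, d], [], by simp⟩))
      exact ⟨d :: v, by rw [sturm_cons_of_ne hy]⟩
    · obtain ⟨v, hv⟩ := exists_eq_sturm hy (d :: w) (by simpa using hd)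
        (fun h => hw (h.trans ⟨[c], [], by simp⟩))
      exact ⟨c :: v, by rw [hv, sturm_cons_self]⟩

theorem sturm_concat_infix {z c d : AB} {f X : Word} (h : c :: (f ++ [d]) <:+: X) :
    c :: (sturm z f ++ [z] ++ [d]) <:+: sturm z X ++ [z] := by
  obtain ⟨l, r, rfl⟩ := h
  obtain ⟨p, hp⟩ := sturm_cons_ends z c
  obtain ⟨t, ht⟩ := sturm_concat_eq z r []
  have hd : ∃ s, sturm z [d] ++ (sturm z r ++ [z]) = z :: d :: s := by
    by_cases h : d = z
    · exact ⟨t, by simp [ht, h]⟩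
    · exact ⟨z :: t, by simp [ht, sturm_cons_of_ne h]⟩
  obtain ⟨s, hs⟩ := hd
  refine ⟨sturm z l ++ p, s, ?_⟩
  have : l ++ c :: (f ++ [d]) ++ r = l ++ ([c] ++ (f ++ ([d] ++ r))) := by simp
  rw [this]
  simp only [sturm_append, hp, List.append_assoc, hs]
  simp

theorem infix_of_sturm_concat_infix {z c d : AB} {f X : Word}
    (h : c :: (sturm z f ++ [z] ++ [d]) <:+: sturm z X ++ [z]) :
    c :: (f ++ [d]) <:+: X := by
  obtain ⟨l, r, h⟩ := h
  obtain ⟨t, ht⟩ := sturm_concat_eq z f (d :: r)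
  obtain ⟨X₁, X₂, rfl, h1, h2⟩ := exists_split_of_sturm_eq (X := X) (p := l ++ [c]) (s := t)
    (by rw [← h, ← ht]; simp)
  rw [← ht] at h2
  obtain ⟨Y₁, Y₂, rfl, h3, h4⟩ := exists_split_of_sturm_eq h2.symm
  obtain rfl := sturm_injective z h3
  obtain ⟨l', rfl⟩ : ∃ l', X₁ = l' ++ [c] := by
    cases X₁ using List.reverseRecOn with
    | nil => simp at h1
    | append_singleton l' e =>
      obtain ⟨p, hp⟩ := sturm_cons_ends z e
      rw [sturm_append, hp, ← List.append_assoc] at h1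
      have := (List.append_inj' h1 rfl).2
      exact ⟨l', by simp_all⟩
  obtain ⟨r', rfl⟩ : ∃ r', Y₂ = d :: r' := by
    cases Y₂ with
    | nil => simp at h4
    | cons e r' =>
      by_cases he : e = z
      · subst he
        obtain ⟨s, hs⟩ := sturm_concat_eq e r' []
        simp [hs] at h4
        exact ⟨r', by simp [h4]⟩
      · rw [sturm_cons_of_ne he] at h4
        simp at h4
        exact ⟨r', by simp [h4]⟩
  exact ⟨l', r', by simp⟩

theorem noStrongBispecial_sturm_iff (z : AB) (X : Word) :
    NoStrongBispecial (sturm z X ++ [z]) ↔ NoStrongBispecial X := by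
  obtain ⟨y, hy⟩ : ∃ y : AB, y ≠ z := by cases z; exacts [⟨b, by simp⟩, ⟨a, by simp⟩]
  have hsq := not_square_infix_sturm hy X
  constructor
  · exact fun h f hf => h (sturm z f ++ [z]) fun c d => sturm_concat_infix (hf c d)
  · intro h f hf
    have hhead : f.head? ≠ some y := by
      intro hh
      obtain ⟨g, rfl⟩ : ∃ g, f = y :: g := by
        cases f with
        | nil => simp at hh
        | cons e g => exact ⟨g, by simp_all⟩
      exact hsq (.trans ⟨[], g ++ [y], by simp⟩ (hf y y))
    cases f using List.reverseRecOn with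
    | nil => exact hsq (hf y y)
    | append_singleton g e =>
      have he : e = z := by
        refine AB.eq_of_ne_of_ne (z := y) ?_ hy.symm
        rintro rfl
        exact hsq (.trans ⟨e :: g, [], by simp⟩ (hf e e))
      subst he
      obtain ⟨v, rfl⟩ := exists_eq_sturm hy g (by
        intro hh
        cases g <;> simp_all) (fun hg => hsq (hg.trans (.trans ⟨[y], [e, y], by simp⟩ (hf y y))))
      exact h v fun c d => infix_of_sturm_concat_infix (hf c d)

theorem noStrongBispecial_concat {y z : AB} (hy : y ≠ z) {w : Word}
    (hsq : ¬ [y, y] <:+: w ++ [y]) (h : NoStrongBispecial (w ++ [y])) :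
    NoStrongBispecial (w ++ [y] ++ [z]) := by
  intro f hf
  have key : ∀ c d, c :: (f ++ [d]) <:+: w ++ [y] ∨ d = z ∧ c :: f <:+ w ++ [y] := by
    intro c d
    exact concat_infix_concat_iff (u := c :: f).1 (hf c d)
  have hyy : y :: (f ++ [y]) <:+: w ++ [y] := (key y y).resolve_right fun h => hy h.1
  by_cases hs : ∃ c, c :: f <:+ w ++ [y]
  · obtain ⟨c, p, hp⟩ := hs
    cases f using List.reverseRecOn with
    | nil => exact hsq hyy
    | append_singleton g e =>
      rw [← List.cons_append, ← List.append_assoc] at hp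
      have := (List.append_inj' hp rfl).2
      simp only [List.cons.injEq, and_true] at this
      subst this
      exact hsq (.trans ⟨e :: g, [], by simp⟩ hyy)
  · push Not at hs
    exact h f fun c d => (key c d).resolve_right fun h => hs c h.2

theorem noStrongBispecial_cons {y z : AB} (hy : y ≠ z) {w : Word}
    (hsq : ¬ [y, y] <:+: y :: w) (h : NoStrongBispecial (y :: w)) :
    NoStrongBispecial (z :: y :: w) := by
  intro f hf
  have key : ∀ c d, c :: (f ++ [d]) <:+: y :: w ∨ c = z ∧ f ++ [d] <+: y :: w := by
    intro c d
    have := hf c d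
    rw [List.infix_cons_iff, List.cons_prefix_cons] at this
    tauto
  have hyy : y :: (f ++ [y]) <:+: y :: w := (key y y).resolve_right fun h => hy h.1
  by_cases hs : ∃ d, f ++ [d] <+: y :: w
  · obtain ⟨d, hd⟩ := hs
    cases f with
    | nil => exact hsq hyy
    | cons e g =>
      simp only [List.cons_append, List.cons_prefix_cons] at hd
      obtain ⟨rfl, -⟩ := hd
      exact hsq (.trans ⟨[], g ++ [e], by simp⟩ hyy)
  · push Not at hs
    exact h f fun c d => (key c d).resolve_right fun h => hs d h.2

theorem noStrongBispecial_cons_sturm_iff (z x : AB) (w : Word) :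
    NoStrongBispecial (x :: (sturm z w ++ [z])) ↔ NoStrongBispecial (x :: w) := by
  rw [← noStrongBispecial_sturm_iff z (x :: w)]
  by_cases hx : x = z
  · simp [hx]
  · rw [sturm_cons_of_ne hx]
    refine ⟨fun h => noStrongBispecial_cons hx (fun hsq => ?_) h,
      fun h => h.of_infix (List.suffix_cons _ _).isInfix⟩
    refine not_square_infix_sturm hx (x :: w) (hsq.trans ?_)
    rw [sturm_cons_of_ne hx]
    exact (List.suffix_cons _ _).isInfix

/-- Central words, generated from the empty word by the maps `w ↦ sturm z w ++ [z]`. -/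
inductive IsSturmCentral : Word → Prop
  | nil : IsSturmCentral []
  | step (z : AB) {w : Word} (h : IsSturmCentral w) : IsSturmCentral (sturm z w ++ [z])

theorem sturm_replicate_self (z : AB) (n : ℕ) :
    sturm z (List.replicate n z) = List.replicate n z := by
  induction n with
  | zero => rfl
  | succ n ih => simp [List.replicate_succ, ih]

theorem isSturmCentral_replicate (n : ℕ) (z : AB) : IsSturmCentral (List.replicate n z) := by
  induction n with
  | zero => exact .nil
  | succ n ih =>
    have := ih.step z
    rwa [sturm_replicate_self, ← List.replicate_succ'] at this

theorem eq_sturm_of_swap_comm {p q : AB} (hpq : p ≠ q) :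
    ∀ {v : Word}, p :: q :: v = v ++ [q, p] →
      ∃ k, v = sturm p (List.replicate k q) ++ [p]
  | [], h => by simp at h; exact absurd h.1 hpq
  | [e], h => by
    simp at h
    exact ⟨0, by simp [h.1]⟩
  | e :: f :: v, h => by
    simp only [List.cons_append, List.cons.injEq] at h
    obtain ⟨rfl, rfl, h⟩ := h
    obtain ⟨k, hk⟩ := eq_sturm_of_swap_comm hpq h
    exact ⟨k + 1, by rw [hk, List.replicate_succ, sturm_cons_of_ne hpq.symm]; simp⟩

theorem eq_replicate_of_cons_eq_concat {p : AB} :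
    ∀ {u : Word}, u ++ [p] = p :: u → u = List.replicate u.length p
  | [], _ => rfl
  | e :: u, h => by
    simp only [List.cons_append, List.cons.injEq] at h
    obtain ⟨rfl, h⟩ := h
    rw [List.length_cons, List.replicate_succ, ← eq_replicate_of_cons_eq_concat h]

theorem exists_sturm_of_central_pair (n : ℕ) :
    ∀ {p q : AB} {u v : Word}, p ≠ q → u.length + v.length ≤ n → u.length ≤ v.length → u ≠ [] →
      u ++ [p, q] ++ v = v ++ [q, p] ++ u →
      ∃ z u' v', u = sturm z u' ++ [z] ∧ v = sturm z v' ++ [z] := by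
  induction n with
  | zero =>
    intro p q u v _ h _ hu
    exact absurd (List.length_eq_zero_iff.1 (by omega)) hu
  | succ n ih =>
    intro p q u v hpq hn hle hu h
    have hpos := List.length_pos_iff.2 hu
    obtain ⟨t, rfl⟩ : u <+: v := List.prefix_of_prefix_length_le (l₃ := v ++ [q, p] ++ u)
      ⟨[p, q] ++ v, by rw [← h]; simp⟩ ⟨[q, p] ++ u, by simp⟩ hle
    simp only [List.append_assoc, List.append_cancel_left_eq] at h
    match t, h with
    | [], h =>
      simp at h
      exact absurd h.1 hpq
    | [e], h =>
      simp only [List.cons_append, List.nil_append, List.cons.injEq, true_and] at h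
      obtain ⟨rfl, h⟩ := h
      have hr := eq_replicate_of_cons_eq_concat h
      obtain ⟨m, hm⟩ : ∃ m, u.length = m + 1 := ⟨u.length - 1, by omega⟩
      rw [hm] at hr
      refine ⟨p, List.replicate m p, List.replicate (m + 1) p, ?_, ?_⟩
      · rw [sturm_replicate_self, ← List.replicate_succ', hr]
      · rw [sturm_replicate_self, hr]
    | e :: f :: v, h =>
      simp only [List.cons_append, List.nil_append, List.cons.injEq] at h
      obtain ⟨rfl, rfl, h⟩ := h
      simp only [List.length_append, List.length_cons] at hn
      have hv : ∃ z u' v', u = sturm z u' ++ [z] ∧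
          (v = sturm z v' ++ [z] ∨ v = [] ∧ z = q) := by
        by_cases hv : v = []
        · subst hv
          obtain ⟨k, hk⟩ := eq_sturm_of_swap_comm hpq.symm (by simpa using h.symm)
          exact ⟨q, _, [], hk, Or.inr ⟨rfl, rfl⟩⟩
        · rcases le_total u.length v.length with hl | hl
          · obtain ⟨z, u', v', h1, h2⟩ := ih hpq (by omega) hl hu (by simpa using h)
            exact ⟨z, u', v', h1, Or.inl h2⟩
          · obtain ⟨z, u', v', h1, h2⟩ := ih hpq.symm (by omega) hl hv (by simpa using h.symm)
            exact ⟨z, v', u', h2, Or.inl h1⟩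
      obtain ⟨z, u', v', rfl, rfl | ⟨rfl, rfl⟩⟩ := hv
      · refine ⟨z, u', u' ++ [p, q] ++ v', rfl, ?_⟩
        by_cases hp : p = z
        · subst hp
          simp [sturm_cons_of_ne hpq.symm]
        · have : q = z := AB.eq_of_ne_of_ne hpq.symm (Ne.symm hp)
          subst this
          simp [sturm_cons_of_ne hp]
      · exact ⟨z, u', u' ++ [p], rfl, by simp [sturm_cons_of_ne hpq]⟩

theorem sturm_central_pair {p q : AB} (hpq : p ≠ q) (z : AB) (u v : Word) :
    sturm z (u ++ [p, q] ++ v) ++ [z] =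
      (sturm z u ++ [z]) ++ [p, q] ++ (sturm z v ++ [z]) := by
  by_cases hp : p = z
  · subst hp
    simp [sturm_cons_of_ne hpq.symm]
  · have : q = z := AB.eq_of_ne_of_ne hpq.symm (Ne.symm hp)
    subst this
    simp [sturm_cons_of_ne hp]

theorem isSturmCentral_of_pair (n : ℕ) :
    ∀ {p q : AB} {u v : Word}, p ≠ q → u.length + v.length ≤ n →
      u ++ [p, q] ++ v = v ++ [q, p] ++ u → IsSturmCentral (u ++ [p, q] ++ v) := by
  induction n with
  | zero =>
    intro p q u v hpq hn h
    obtain rfl := List.length_eq_zero_iff.1 (show u.length = 0 by omega)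
    obtain rfl := List.length_eq_zero_iff.1 (show v.length = 0 by omega)
    simp at h
    exact absurd h.1 hpq
  | succ n ih =>
    intro p q u v hpq hn h
    by_cases hu : u = []
    · subst hu
      obtain ⟨k, rfl⟩ := eq_sturm_of_swap_comm hpq (by simpa using h)
      convert (isSturmCentral_replicate (k + 1) q).step p using 1
      simp [List.replicate_succ, sturm_cons_of_ne hpq.symm]
    by_cases hv : v = []
    · subst hv
      obtain ⟨k, rfl⟩ := eq_sturm_of_swap_comm hpq.symm (by simpa using h.symm)
      convert (isSturmCentral_replicate (k + 1) p).step q using 1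
      simp [List.replicate_succ', sturm_cons_of_ne hpq]
    obtain ⟨z, u', v', rfl, rfl⟩ : ∃ z u' v', u = sturm z u' ++ [z] ∧ v = sturm z v' ++ [z] := by
      rcases le_total u.length v.length with hl | hl
      · exact exists_sturm_of_central_pair _ hpq le_rfl hl hu h
      · obtain ⟨z, v', u', h1, h2⟩ := exists_sturm_of_central_pair _ hpq.symm le_rfl hl hv h.symm
        exact ⟨z, u', v', h2, h1⟩
    rw [← sturm_central_pair hpq, ← sturm_central_pair hpq.symm] at h
    rw [← sturm_central_pair hpq]
    refine (ih hpq ?_ (sturm_injective z (List.append_cancel_right h))).step z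
    have h1 := length_le_length_sturm z u'
    have h2 := length_le_length_sturm z v'
    simp at hn
    omega

theorem isCentral_of_pair {p q : AB} {u v : Word} (hpq : p ≠ q)
    (h : u ++ [p, q] ++ v = v ++ [q, p] ++ u) : IsCentral (u ++ [p, q] ++ v) := by
  cases p <;> cases q
  · exact absurd rfl hpq
  · exact Or.inr (Or.inr ⟨u, v, rfl, h⟩)
  · exact Or.inr (Or.inr ⟨v, u, h, rfl⟩)
  · exact absurd rfl hpq

theorem isCentral_iff_sturm (w : Word) : IsCentral w ↔ IsSturmCentral w := by
  constructor
  · rintro (⟨n, rfl⟩ | ⟨n, rfl⟩ | ⟨u, v, rfl, h⟩)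
    · exact isSturmCentral_replicate n _
    · exact isSturmCentral_replicate n _
    · exact isSturmCentral_of_pair _ (by simp) le_rfl h
  · intro h
    have hrep : ∀ n c, IsCentral (List.replicate n c) := by
      rintro n (_ | _)
      · exact Or.inl ⟨n, rfl⟩
      · exact Or.inr (Or.inl ⟨n, rfl⟩)
    have hstep_rep : ∀ n c z, IsCentral (sturm z (List.replicate n c) ++ [z]) := by
      intro n c z
      by_cases hc : c = z
      · subst hc
        rw [sturm_replicate_self, ← List.replicate_succ']
        exact hrep _ _
      · cases n with
        | zero => exact hrep 1 z
        | succ n =>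
          have h1 : sturm z (List.replicate (n + 1) c) ++ [z] =
              (sturm z (List.replicate n c) ++ [z]) ++ [c, z] ++ [] := by
            simp [List.replicate_succ', sturm_cons_of_ne hc]
          have h2 : sturm z (List.replicate (n + 1) c) ++ [z] =
              [] ++ [z, c] ++ (sturm z (List.replicate n c) ++ [z]) := by
            simp [List.replicate_succ, sturm_cons_of_ne hc]
          rw [h1]
          exact isCentral_of_pair hc (h1.symm.trans h2)
    induction h with
    | nil => exact hrep 0 a
    | step z _ ih =>
      rcases ih with ⟨n, rfl⟩ | ⟨n, rfl⟩ | ⟨u, v, rfl, h⟩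
      · exact hstep_rep _ _ _
      · exact hstep_rep _ _ _
      · rw [sturm_central_pair (by simp)]
        refine isCentral_of_pair (by simp) ?_
        rw [← sturm_central_pair (by simp), ← sturm_central_pair (by simp), h]

/-- The `n`-th power of the word `r`. -/
def wordPow (r : Word) (n : ℕ) : Word := (List.replicate n r).flatten

theorem wordPow_succ (r : Word) (n : ℕ) : wordPow r (n + 1) = r ++ wordPow r n := by
  simp [wordPow, List.replicate_succ]

theorem wordPow_add (r : Word) (m n : ℕ) : wordPow r (m + n) = wordPow r m ++ wordPow r n := by
  rw [wordPow, List.replicate_add, List.flatten_append]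
  rfl

theorem length_wordPow (r : Word) (n : ℕ) : (wordPow r n).length = n * r.length := by
  simp [wordPow]

theorem wordPow_prefix_wordPow (r : Word) {m n : ℕ} (h : m ≤ n) : wordPow r m <+: wordPow r n := by
  obtain ⟨k, rfl⟩ := Nat.exists_eq_add_of_le h
  exact ⟨_, (wordPow_add r m k).symm⟩

theorem sturm_wordPow (z : AB) (r : Word) (n : ℕ) :
    sturm z (wordPow r n) = wordPow (sturm z r) n := by
  induction n with
  | zero => rfl
  | succ n ih => rw [wordPow_succ, wordPow_succ, sturm_append, ih]

theorem cons_wordPow_of_conj {z : AB} {r s : Word} (h : z :: s = r ++ [z]) (n : ℕ) :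
    z :: wordPow s n = wordPow r n ++ [z] := by
  induction n with
  | zero => rfl
  | succ n ih =>
    rw [wordPow_succ, wordPow_succ, ← List.cons_append, h, List.append_assoc, List.append_assoc,
      ← ih]
    rfl

/-- `X` is a prefix of the infinite power of `r`. -/
def IsPowPrefix (r X : Word) : Prop := ∃ n, X <+: wordPow r n

theorem IsPowPrefix.of_prefix {r X Y : Word} (hY : IsPowPrefix r Y) (h : X <+: Y) :
    IsPowPrefix r X :=
  hY.imp fun _ hn => h.trans hn

theorem IsPowPrefix.prefix_of_length_le {r X Y : Word} (hX : IsPowPrefix r X)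
    (hY : IsPowPrefix r Y) (h : X.length ≤ Y.length) : X <+: Y := by
  obtain ⟨m, hm⟩ := hX
  obtain ⟨n, hn⟩ := hY
  exact List.prefix_of_prefix_length_le (hm.trans (wordPow_prefix_wordPow r (le_max_left m n)))
    (hn.trans (wordPow_prefix_wordPow r (le_max_right m n))) h

theorem isPowPrefix_iff {r X : Word} (hr : r ≠ []) : IsPowPrefix r X ↔ X <+: r ++ X := by
  have hpos := List.length_pos_iff.2 hr
  constructor
  · rintro ⟨n, hn⟩
    refine IsPowPrefix.prefix_of_length_le (r := r) ⟨n, hn⟩ ⟨n + 1, ?_⟩ (by simp)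
    rw [wordPow_succ]
    exact (List.prefix_append_right_inj r).2 hn
  · intro h
    have key : ∀ n, X <+: wordPow r n ++ X := by
      intro n
      induction n with
      | zero => exact List.prefix_rfl
      | succ n ih =>
        rw [wordPow_succ, List.append_assoc]
        exact h.trans ((List.prefix_append_right_inj r).2 ih)
    refine ⟨X.length, List.prefix_of_prefix_length_le (key X.length) ⟨X, rfl⟩ ?_⟩
    rw [length_wordPow]
    exact Nat.le_mul_of_pos_right _ hpos

theorem sturm_concat_prefix {z : AB} {X Y : Word} (h : X <+: Y) :
    sturm z X ++ [z] <+: sturm z Y ++ [z] := by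
  obtain ⟨t, rfl⟩ := h
  obtain ⟨s, hs⟩ := sturm_concat_eq z t []
  exact ⟨s, by simp [hs]⟩

theorem prefix_of_sturm_concat_prefix {z : AB} {X Y : Word}
    (h : sturm z X ++ [z] <+: sturm z Y ++ [z]) : X <+: Y := by
  obtain ⟨t, ht⟩ := h
  obtain ⟨Y₁, Y₂, rfl, h1, -⟩ := exists_split_of_sturm_eq (z := z) (X := Y) (p := sturm z X)
    (s := t) (by rw [← ht]; simp)
  obtain rfl := sturm_injective z h1
  exact ⟨Y₂, rfl⟩

/-- The root of the periodic word `nextWord z y X` when `X` has root `r`. -/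
def nextRoot (z y : AB) (r : Word) : Word :=
  if y = z then sturm z r else (sturm z r ++ [z]).tail

/-- The word `sturm z X ++ [z]`, without its first letter in case `y ≠ z`. -/
def nextWord (z y : AB) (X : Word) : Word :=
  if y = z then sturm z X ++ [z] else (sturm z X ++ [z]).tail

/-- The word `sturm z X ++ [z]`, without its first letter in case `y = z`. -/
def nextTail (z y : AB) (X : Word) : Word :=
  if y = z then (sturm z X ++ [z]).tail else sturm z X ++ [z]

theorem cons_tail_sturm_concat (z : AB) (X : Word) :
    z :: (sturm z X ++ [z]).tail = sturm z X ++ [z] := by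
  obtain ⟨t, ht⟩ := sturm_concat_eq z X []
  simp [ht]

theorem length_nextRoot (z y : AB) (r : Word) :
    (nextRoot z y r).length = (sturm z r).length := by
  by_cases h : y = z <;> simp [nextRoot, h]

theorem IsPowPrefix.next {z y : AB} {r X : Word} (hr : r ≠ []) (h : IsPowPrefix r X) :
    IsPowPrefix (nextRoot z y r) (nextWord z y X) := by
  obtain ⟨n, hn⟩ := h
  have h1 := sturm_concat_prefix (z := z) hn
  rw [sturm_wordPow] at h1
  by_cases hy : y = z
  · simp only [nextRoot, nextWord, hy, if_true]
    refine ⟨n + 1, h1.trans ?_⟩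
    rw [wordPow_add, List.prefix_append_right_inj]
    obtain ⟨c, r, rfl⟩ := List.exists_cons_of_ne_nil hr
    obtain ⟨s, hs⟩ := sturm_cons_eq z c r
    exact ⟨s, by simp [hs, wordPow]⟩
  · simp only [nextRoot, nextWord, hy, if_false]
    refine ⟨n, ?_⟩
    have h2 := cons_wordPow_of_conj (cons_tail_sturm_concat z r) n
    rw [← h2, ← cons_tail_sturm_concat z X, List.cons_prefix_cons] at h1
    exact h1.2

theorem nextWord_cons (z y : AB) (u : Word) :
    nextWord z y (y :: u) = y :: (sturm z u ++ [z]) := by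
  by_cases hy : y = z
  · simp [nextWord, hy]
  · simp [nextWord, hy, sturm_cons_of_ne hy]

theorem nextWord_overlap (z y : AB) (u q : Word) :
    nextWord z y ([y] ++ u ++ [y] ++ q) =
      [y] ++ (sturm z u ++ [z]) ++ [y] ++ nextTail z y q := by
  by_cases hy : y = z
  · subst hy
    obtain ⟨t, ht⟩ := sturm_concat_eq y q []
    simp [nextWord, nextTail, ht]
  · simp [nextWord, nextTail, hy, sturm_cons_of_ne hy]

theorem sturm_overlap {x y : AB} (hxy : x ≠ y) (z : AB) (u q : Word) :
    sturm z (u ++ [x] ++ [y] ++ u ++ [y] ++ q) ++ [z] =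
      (sturm z u ++ [z]) ++ [x] ++ [y] ++ (sturm z u ++ [z]) ++ [y] ++ nextTail z y q := by
  by_cases hy : y = z
  · subst hy
    obtain ⟨t, ht⟩ := sturm_concat_eq y q []
    simp [nextTail, sturm_cons_of_ne hxy, ht]
  · have : x = z := AB.eq_of_ne_of_ne hxy (Ne.symm hy)
    subst this
    simp [nextTail, hy, sturm_cons_of_ne hy]

/-- `r` is the shortest root of the word `yu`, and it is also a root of `yuy`. -/
structure IsMinRoot (r : Word) (y : AB) (u : Word) : Prop where
  ne_nil : r ≠ []
  isPrefix : r <+: y :: u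
  isPowPrefix : IsPowPrefix r ([y] ++ u ++ [y])
  minimal : ∀ R : Word, R ≠ [] → y :: u <+: R ++ y :: u → r.length ≤ R.length

theorem IsMinRoot.unique {r s : Word} {y : AB} {u : Word} (hr : IsMinRoot r y u)
    (hs : IsMinRoot s y u) : r = s := by
  have h1 : ∀ {t : Word}, IsMinRoot t y u → y :: u <+: t ++ y :: u := fun {t} ht =>
    (isPowPrefix_iff ht.ne_nil).1 (ht.isPowPrefix.of_prefix ⟨[y], by simp⟩)
  have hl : r.length = s.length :=
    le_antisymm (hr.minimal s hs.ne_nil (h1 hs)) (hs.minimal r hr.ne_nil (h1 hr))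
  exact (List.prefix_of_prefix_length_le hr.isPrefix hs.isPrefix hl.le).eq_of_length hl

theorem isMinRoot_singleton (y : AB) : IsMinRoot [y] y [] where
  ne_nil := by simp
  isPrefix := List.prefix_rfl
  isPowPrefix := ⟨2, by simp [wordPow, List.replicate_succ]⟩
  minimal R hR _ := List.length_pos_iff.2 hR

theorem exists_root_of_next {z y : AB} {u R : Word} (hR : R ≠ [])
    (hlt : R.length < (y :: (sturm z u ++ [z])).length)
    (h : y :: (sturm z u ++ [z]) <+: R ++ y :: (sturm z u ++ [z])) :
    ∃ S, S ≠ [] ∧ S <+: y :: u ∧ y :: u <+: S ++ y :: u ∧ (sturm z S).length = R.length := by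
  have key : ∃ R' s : Word, R'.length = R.length ∧ sturm z (y :: u) ++ [z] = R' ++ z :: s ∧
      z :: s <+: sturm z (y :: u) ++ [z] := by
    obtain ⟨s, hs⟩ : R <+: y :: (sturm z u ++ [z]) :=
      List.prefix_of_prefix_length_le ⟨_, rfl⟩ h hlt.le
    have hs' : s <+: y :: (sturm z u ++ [z]) := by
      conv at h => lhs; rw [← hs]
      exact (List.prefix_append_right_inj R).1 h
    have hne : s ≠ [] := by
      rintro rfl
      rw [← hs] at hlt
      simp at hlt
    obtain ⟨e, s, rfl⟩ := List.exists_cons_of_ne_nil hne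
    obtain rfl : e = y := (List.cons_prefix_cons.1 hs').1
    by_cases hy : e = z
    · subst hy
      exact ⟨R, s, rfl, by simp [← hs], by simpa using hs'⟩
    · have hW : sturm z (e :: u) ++ [z] = z :: e :: (sturm z u ++ [z]) := by
        simp [sturm_cons_of_ne hy]
      rw [hW]
      cases R using List.reverseRecOn with
      | nil => exact absurd rfl hR
      | append_singleton R f =>
        have hf : f = z := by
          refine AB.eq_of_ne_of_ne (z := e) ?_ (Ne.symm hy)
          rintro rfl
          refine not_square_infix_sturm hy (f :: u) ⟨z :: R, s, ?_⟩
          rw [hW, ← hs]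
          simp
        subst hf
        exact ⟨f :: R, e :: s, by simp, by simp [← hs], List.cons_prefix_cons.2 ⟨rfl, hs'⟩⟩
  obtain ⟨R', s, hl, h1, h2⟩ := key
  obtain ⟨S, S', h3, rfl, h5⟩ := exists_split_of_sturm_eq h1
  rw [h5] at h2
  refine ⟨S, ?_, ⟨S', h3.symm⟩, ?_, hl⟩
  · rintro rfl
    exact hR (List.length_eq_zero_iff.1 hl.symm)
  · conv_lhs => rw [h3]
    exact (List.prefix_append_right_inj S).2 (prefix_of_sturm_concat_prefix h2)

theorem IsMinRoot.next {r : Word} {y : AB} {u : Word} (h : IsMinRoot r y u) (z : AB) :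
    IsMinRoot (nextRoot z y r) y (sturm z u ++ [z]) := by
  have hpre : nextRoot z y r <+: y :: (sturm z u ++ [z]) := by
    rw [← nextWord_cons]
    obtain ⟨t, ht⟩ := h.isPrefix
    by_cases hy : y = z
    · simp only [nextRoot, nextWord, hy, if_true]
      rw [hy] at ht
      exact ⟨sturm z t ++ [z], by rw [← ht]; simp⟩
    · simp only [nextRoot, nextWord, hy, if_false]
      have h1 := sturm_concat_prefix (z := z) h.isPrefix
      rw [← cons_tail_sturm_concat z r, ← cons_tail_sturm_concat z (y :: u),
        List.cons_prefix_cons] at h1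
      exact h1.2
  refine ⟨?_, hpre, ?_, ?_⟩
  · rw [← List.length_pos_iff, length_nextRoot, List.length_pos_iff]
    exact sturm_length_pos h.ne_nil
  · refine (h.isPowPrefix.next (z := z) (y := y) h.ne_nil).of_prefix ?_
    have := nextWord_overlap z y u []
    rw [List.append_nil] at this
    rw [this]
    exact List.prefix_append _ _
  · intro R hR hRu
    by_contra! hlt
    obtain ⟨S, hS, hSu, hper, hl⟩ := exists_root_of_next hR (hlt.trans_le hpre.length_le) hRu
    obtain ⟨t, rfl⟩ := List.prefix_of_prefix_length_le h.isPrefix hSu (h.minimal S hS hper)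
    rw [length_nextRoot] at hlt
    simp at hl
    omega

theorem IsSturmCentral.exists_isMinRoot {u : Word} (hu : IsSturmCentral u) (y : AB) :
    ∃ r, IsMinRoot r y u := by
  induction hu with
  | nil => exact ⟨_, isMinRoot_singleton y⟩
  | step z _ ih =>
    obtain ⟨r, hr⟩ := ih
    exact ⟨_, hr.next z⟩

theorem minPeriod_le {r X : Word} (hr : r ≠ []) (hle : r.length ≤ X.length) (h : X <+: r ++ X) :
    minPeriod X ≤ r.length := by
  have hpos := List.length_pos_iff.2 hr
  obtain ⟨v, rfl⟩ : r <+: X := List.prefix_of_prefix_length_le ⟨X, rfl⟩ h hle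
  have hbdd : BddAbove {n | ∃ t : Word, t.length = n ∧ t <+: r ++ v ∧ t ≠ r ++ v ∧ t <:+ r ++ v} :=
    ⟨(r ++ v).length, by rintro _ ⟨t, rfl, ht, -⟩; exact ht.length_le⟩
  have := le_csSup hbdd ⟨v, rfl, (List.prefix_append_right_inj r).1 h, by simpa using hr,
    List.suffix_append _ _⟩
  rw [minPeriod, List.length_append]
  omega

theorem exists_root_length_eq_minPeriod {X : Word} (hX : X ≠ []) :
    ∃ R : Word, R ≠ [] ∧ R.length = minPeriod X ∧ R <+: X ∧ X <+: R ++ X := by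
  have hbdd : BddAbove {n | ∃ t : Word, t.length = n ∧ t <+: X ∧ t ≠ X ∧ t <:+ X} :=
    ⟨X.length, by rintro _ ⟨t, rfl, ht, -⟩; exact ht.length_le⟩
  obtain ⟨t, htl, htp, htne, R, rfl⟩ := Nat.sSup_mem
    (s := {n | ∃ t : Word, t.length = n ∧ t <+: X ∧ t ≠ X ∧ t <:+ X})
    ⟨0, [], rfl, List.nil_prefix, hX.symm, List.nil_suffix⟩ hbdd
  refine ⟨R, ?_, ?_, List.prefix_append _ _, (List.prefix_append_right_inj R).2 htp⟩
  · rintro rfl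
    exact htne rfl
  · rw [minPeriod, ← htl, List.length_append]
    omega

theorem IsMinRoot.minPeriod_eq_iff {r : Word} {y : AB} {u : Word} (h : IsMinRoot r y u)
    (q : Word) : minPeriod ([y] ++ u ++ [y] ++ q) = minPeriod ([y] ++ u) ↔
      IsPowPrefix r ([y] ++ u ++ [y] ++ q) := by
  have hpre : y :: u <+: [y] ++ u ++ [y] ++ q := ⟨[y] ++ q, by simp⟩
  have hmin : ∀ R : Word, R ≠ [] → [y] ++ u ++ [y] ++ q <+: R ++ ([y] ++ u ++ [y] ++ q) →
      r.length ≤ R.length := by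
    intro R hR hRY
    refine h.minimal R hR (List.prefix_of_prefix_length_le (hpre.trans hRY)
      ((List.prefix_append_right_inj R).2 hpre) (by simp))
  have hyu : minPeriod ([y] ++ u) = r.length := by
    refine le_antisymm (minPeriod_le h.ne_nil h.isPrefix.length_le
      ((isPowPrefix_iff h.ne_nil).1 (h.isPowPrefix.of_prefix ⟨[y], rfl⟩))) ?_
    obtain ⟨R, hR, hl, -, hRX⟩ := exists_root_length_eq_minPeriod (X := [y] ++ u) (by simp)
    rw [← hl]
    exact h.minimal R hR hRX
  obtain ⟨R, hR, hl, hRp, hRX⟩ :=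
    exists_root_length_eq_minPeriod (X := [y] ++ u ++ [y] ++ q) (by simp)
  rw [hyu]
  constructor
  · intro heq
    obtain rfl : R = r := (List.prefix_of_prefix_length_le hRp (h.isPrefix.trans hpre)
      (by omega)).eq_of_length (by omega)
    exact (isPowPrefix_iff hR).2 hRX
  · intro hpow
    refine le_antisymm (minPeriod_le h.ne_nil (h.isPrefix.trans hpre).length_le
      ((isPowPrefix_iff h.ne_nil).1 hpow)) ?_
    rw [← hl]
    exact hmin R hR hRX

/-- Both one-letter left extensions of `w` are free of strong bispecial factors. -/
def IsLeftExtendable (w : Word) : Prop := ∀ c : AB, NoStrongBispecial (c :: w)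

theorem isLeftExtendable_sturm_iff {z : AB} {w : Word} :
    IsLeftExtendable (sturm z w ++ [z]) ↔ IsLeftExtendable w :=
  forall_congr' fun c => noStrongBispecial_cons_sturm_iff z c w

theorem IsLeftExtendable.of_prefix {v w : Word} (hw : IsLeftExtendable w) (h : v <+: w) :
    IsLeftExtendable v :=
  fun c => (hw c).of_infix (List.cons_prefix_cons.2 ⟨rfl, h⟩).isInfix

/-- Words of the form `uxyuyq` with `u` central and `yuyq` sharing its shortest root with `yu`. -/
def IsPeriodicOverlap (w : Word) : Prop :=
  ∃ (u q : Word) (x y : AB) (r : Word), x ≠ y ∧ IsSturmCentral u ∧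
    w = u ++ [x] ++ [y] ++ u ++ [y] ++ q ∧ IsMinRoot r y u ∧ IsPowPrefix r ([y] ++ u ++ [y] ++ q)

theorem IsSturmCentral.isLeftExtendable {w : Word} (h : IsSturmCentral w) :
    IsLeftExtendable w := by
  induction h with
  | nil =>
    intro c f hf
    have := (hf a a).length_le
    simp at this
  | step z _ ih => exact isLeftExtendable_sturm_iff.2 ih

theorem isLeftExtendable_cons_replicate {x y : AB} (hxy : x ≠ y) (n : ℕ) :
    IsLeftExtendable (x :: List.replicate n y) := by
  intro c f hf
  have key : ∀ e, e = c := by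
    intro e
    obtain ⟨l, r, h⟩ := hf e x
    cases l with
    | nil =>
      simp at h
      exact h.1
    | cons d l =>
      simp only [List.cons_append, List.append_assoc, List.cons.injEq] at h
      have hx : x ∈ List.replicate n y := by
        have h2 := h.2
        cases l with
        | nil =>
          simp at h2
          rw [← h2.2]
          simp
        | cons g l =>
          simp at h2
          rw [← h2.2]
          simp
      exact absurd (List.eq_of_mem_replicate hx) hxy
  exact absurd ((key x).trans (key y).symm) hxy

theorem wordPow_singleton (y : AB) (n : ℕ) : wordPow [y] n = List.replicate n y := by
  simp [wordPow]

theorem isLeftExtendable_of_overlap {u : Word} (hu : IsSturmCentral u) {x y : AB} (hxy : x ≠ y) :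
    ∀ {q r : Word}, IsMinRoot r y u → IsPowPrefix r ([y] ++ u ++ [y] ++ q) →
      IsLeftExtendable (u ++ [x] ++ [y] ++ u ++ [y] ++ q) := by
  induction hu with
  | nil =>
    intro q r hr hq
    rw [hr.unique (isMinRoot_singleton y)] at hq
    obtain ⟨n, hn⟩ := hq
    rw [wordPow_singleton] at hn
    refine (isLeftExtendable_cons_replicate hxy n).of_prefix ?_
    simpa using hn
  | @step z u hu ih =>
    intro q r hr hq
    obtain ⟨s, hs⟩ := hu.exists_isMinRoot y
    rw [hr.unique (hs.next z)] at hq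
    obtain ⟨q', hq', hlen⟩ : ∃ q', IsPowPrefix s ([y] ++ u ++ [y] ++ q') ∧
        q.length ≤ q'.length := by
      obtain ⟨m, hm⟩ := hs.isPowPrefix
      have hm' := hm.trans (wordPow_prefix_wordPow s
        (le_max_left m (([y] ++ u ++ [y]).length + q.length)))
      obtain ⟨q', hq'⟩ := hm'
      refine ⟨q', ⟨max m (([y] ++ u ++ [y]).length + q.length), by rw [hq']⟩, ?_⟩
      have h1 := congrArg List.length hq'
      rw [length_wordPow, List.length_append] at h1
      have h2 := List.length_pos_iff.2 hs.ne_nil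
      have h3 := Nat.le_mul_of_pos_right (max m (([y] ++ u ++ [y]).length + q.length)) h2
      omega
    have h1 := hq'.next (z := z) (y := y) hs.ne_nil
    rw [nextWord_overlap] at h1
    have hq'' : q.length ≤ (nextTail z y q').length := by
      have := length_le_length_sturm z q'
      by_cases hy : y = z <;> simp [nextTail, hy] <;> omega
    have h2 := hq.prefix_of_length_le h1 (by simpa using hq'')
    rw [List.prefix_append_right_inj] at h2
    have h3 := isLeftExtendable_sturm_iff (z := z).2 (ih hs hq')
    rw [sturm_overlap hxy] at h3
    exact h3.of_prefix ((List.prefix_append_right_inj _).2 h2)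

theorem eq_replicate_of_not_infix {y z : AB} (hy : y ≠ z) :
    ∀ {t : Word}, ¬ [y, z] <:+: y :: t → t = List.replicate t.length y
  | [], _ => rfl
  | c :: t, h => by
    have hc : c = y := by
      refine AB.eq_of_ne_of_ne (z := z) ?_ hy
      rintro rfl
      exact h ⟨[], t, by simp⟩
    subst hc
    rw [List.length_cons, List.replicate_succ,
      ← eq_replicate_of_not_infix hy fun h' => h (h'.trans (List.suffix_cons _ _).isInfix)]

theorem IsLeftExtendable.eq_of_square_infix {y z : AB} (hy : y ≠ z) {t : Word}
    (h : IsLeftExtendable (z :: t)) (hsq : [y, y] <:+: z :: t) :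
    ∃ m, z :: t = z :: List.replicate (m + 2) y := by
  have hzy : [z, y] <:+: z :: t := by
    by_contra hn
    have hmem : y ∈ z :: t := hsq.subset (by simp)
    rw [eq_replicate_of_not_infix hy.symm hn] at hmem
    rcases List.mem_cons.1 hmem with h1 | h1
    · exact hy h1
    · exact hy (List.eq_of_mem_replicate h1)
  have hcons : ∀ {v : Word} (c : AB), v <:+: z :: t → v <:+: c :: z :: t := fun c hv =>
    hv.trans (List.suffix_cons _ _).isInfix
  have hyz : ¬ [y, z] <:+: z :: t := by
    intro hyz
    refine h z [] fun c d => ?_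
    by_cases hc : c = z
    · subst hc
      by_cases hd : d = c
      · subst hd
        exact ⟨[], t, by simp⟩
      · obtain rfl := AB.eq_of_ne_of_ne hd hy
        exact hcons _ hzy
    · obtain rfl := AB.eq_of_ne_of_ne hc hy
      by_cases hd : d = z
      · subst hd
        exact hcons _ hyz
      · obtain rfl := AB.eq_of_ne_of_ne hd hy
        exact hcons _ hsq
  have hzz : ¬ [z, z] <:+: z :: t := by
    intro hzz
    refine h y [] fun c d => ?_
    by_cases hc : c = z
    · subst hc
      by_cases hd : d = c
      · subst hd
        exact hcons _ hzz
      · obtain rfl := AB.eq_of_ne_of_ne hd hy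
        exact hcons _ hzy
    · obtain rfl := AB.eq_of_ne_of_ne hc hy
      by_cases hd : d = z
      · subst hd
        exact ⟨[], t, by simp⟩
      · obtain rfl := AB.eq_of_ne_of_ne hd hy
        exact hcons _ hsq
  cases t with
  | nil =>
    have := hsq.length_le
    simp at this
  | cons c t =>
    have hc : c = y := by
      refine AB.eq_of_ne_of_ne (z := z) ?_ hy
      rintro rfl
      exact hzz ⟨[], t, by simp⟩
    subst hc
    have ht := eq_replicate_of_not_infix hy
      fun h' => hyz (h'.trans (List.suffix_cons _ _).isInfix)
    cases t with
    | nil => simp [List.infix_cons_iff, hy] at hsq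
    | cons d t =>
      refine ⟨t.length, ?_⟩
      rw [ht]
      simp [List.replicate_succ]

theorem IsLeftExtendable.concat {y z : AB} (hy : y ≠ z) {v : Word}
    (h : IsLeftExtendable (v ++ [y])) (hhead : (v ++ [y]).head? ≠ some y)
    (hsq : ¬ [y, y] <:+: v ++ [y]) : IsLeftExtendable (v ++ [y] ++ [z]) := by
  intro c
  refine noStrongBispecial_concat (w := c :: v) hy ?_ (h c)
  intro hs
  rw [List.cons_append, List.infix_cons_iff] at hs
  rcases hs with hs | hs
  · obtain ⟨t, ht⟩ := (List.cons_prefix_cons.1 hs).2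
    rw [← ht] at hhead
    simp at hhead
  · exact hsq hs

theorem IsPeriodicOverlap.next {w : Word} (h : IsPeriodicOverlap w) (z : AB) :
    IsPeriodicOverlap (sturm z w ++ [z]) := by
  obtain ⟨u, q, x, y, r, hxy, hu, rfl, hr, hq⟩ := h
  refine ⟨_, nextTail z y q, x, y, _, hxy, hu.step z, sturm_overlap hxy z u q, hr.next z, ?_⟩
  rw [← nextWord_overlap]
  exact hq.next hr.ne_nil

theorem IsPeriodicOverlap.next_dropLast {v : Word} {y z : AB} (hy : y ≠ z)
    (h : IsPeriodicOverlap (v ++ [y])) : IsPeriodicOverlap (sturm z (v ++ [y])) := by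
  obtain ⟨u, q, x, c, r, hxc, hu, hv, hr, hq⟩ := h
  have h1 := hq.next (z := z) (y := c) hr.ne_nil
  have h2 := sturm_overlap hxc z u q
  rw [← hv] at h2
  rw [nextWord_overlap] at h1
  generalize nextTail z c q = t at h1 h2
  cases t using List.reverseRecOn with
  | nil =>
    rw [List.append_nil] at h2
    have h3 := congrArg List.getLast? (List.append_inj' h2 rfl).1
    simp only [sturm_append, sturm_cons_of_ne hy, sturm_nil, ← List.append_assoc] at h3
    simp [List.getLast?_append, List.getLast?_cons, hy] at h3
  | append_singleton t e =>
    rw [← List.append_assoc] at h1 h2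
    exact ⟨_, t, x, c, _, hxc, hu.step z, (List.append_inj' h2 rfl).1, hr.next z,
      h1.of_prefix (List.prefix_append _ _)⟩

theorem IsLeftExtendable.prefix_central_or_overlap (n : ℕ) :
    ∀ {w : Word}, w.length ≤ n → IsLeftExtendable w →
      (∃ c, IsSturmCentral c ∧ w <+: c) ∨ IsPeriodicOverlap w := by
  induction n with
  | zero =>
    intro w hw _
    obtain rfl := List.length_eq_zero_iff.1 (show w.length = 0 by omega)
    exact Or.inl ⟨[], .nil, List.prefix_rfl⟩
  | succ n ih =>
    intro w hw h
    cases w with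
    | nil => exact Or.inl ⟨[], .nil, List.prefix_rfl⟩
    | cons z t =>
      obtain ⟨y, hy⟩ : ∃ y : AB, y ≠ z := by cases z; exacts [⟨b, by simp⟩, ⟨a, by simp⟩]
      by_cases hsq : [y, y] <:+: z :: t
      · obtain ⟨m, hm⟩ := h.eq_of_square_infix hy hsq
        rw [hm]
        refine Or.inr ⟨[], List.replicate m y, z, y, [y], hy.symm, .nil, ?_,
          isMinRoot_singleton y, m + 2, ?_⟩
        · simp [List.replicate_succ]
        · simp [wordPow_singleton, List.replicate_succ]
      · have hhead : (z :: t).head? ≠ some y := by simpa using hy.symm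
        obtain ⟨v, hv⟩ := exists_eq_sturm hy (z :: t) hhead hsq
        rw [hv] at h hw hsq hhead ⊢
        cases v using List.reverseRecOn with
        | nil => simp at hv
        | append_singleton v e =>
          have hlen := length_le_length_sturm z v
          by_cases he : e = z
          · subst he
            have hs : sturm e (v ++ [e]) = sturm e v ++ [e] := by simp
            rw [hs] at h hw ⊢
            simp at hw
            rcases ih (by omega) (isLeftExtendable_sturm_iff.1 h) with ⟨c, hc, hvc⟩ | hv
            · exact Or.inl ⟨_, hc.step e, sturm_concat_prefix hvc⟩
            · exact Or.inr (hv.next e)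
          · obtain rfl := AB.eq_of_ne_of_ne he hy
            have hs : sturm z (v ++ [e]) = sturm z v ++ [z] ++ [e] := by
              simp [sturm_cons_of_ne he]
            have hlv : (v ++ [e]).length ≤ n := by
              rw [hs] at hw
              simp at hw ⊢
              omega
            have hext : IsLeftExtendable (sturm z (v ++ [e]) ++ [z]) := by
              rw [hs] at h hsq hhead ⊢
              exact h.concat hy hhead hsq
            rcases ih hlv (isLeftExtendable_sturm_iff.1 hext) with ⟨c, hc, hvc⟩ | hv
            · exact Or.inl ⟨_, hc.step z, (List.prefix_append _ _).trans (sturm_concat_prefix hvc)⟩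
            · exact Or.inr (hv.next_dropLast hy)

/-- characterization of left special trapezoidal words. -/
theorem left_special_trapezoidal_characterization (w : Word) (htrap : IsTrapezoidal w) :
    (IsTrapezoidal (AB.a :: w) ∧ IsTrapezoidal (AB.b :: w)) ↔
      ((∃ c : Word, IsCentral c ∧ w <+: c) ∨
       (∃ (u q : Word) (x y : AB), x ≠ y ∧ IsCentral u ∧
          w = u ++ [x] ++ [y] ++ u ++ [y] ++ q ∧
          minPeriod ([y] ++ u ++ [y] ++ q) = minPeriod ([y] ++ u))) := by
  have hext : (IsTrapezoidal (AB.a :: w) ∧ IsTrapezoidal (AB.b :: w)) ↔ IsLeftExtendable w := by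
    rw [isTrapezoidal_iff, isTrapezoidal_iff]
    exact ⟨fun h c => by cases c; exacts [h.1, h.2], fun h => ⟨h _, h _⟩⟩
  rw [hext]
  simp only [isCentral_iff_sturm]
  constructor
  · intro h
    refine (IsLeftExtendable.prefix_central_or_overlap _ le_rfl h).imp_right ?_
    rintro ⟨u, q, x, y, r, hxy, hu, hw, hr, hq⟩
    exact ⟨u, q, x, y, hxy, hu, hw, (hr.minPeriod_eq_iff q).2 hq⟩
  · rintro (⟨c, hc, hwc⟩ | ⟨u, q, x, y, hxy, hu, rfl, hq⟩)
    · exact hc.isLeftExtendable.of_prefix hwc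
    · obtain ⟨r, hr⟩ := hu.exists_isMinRoot y
      exact isLeftExtendable_of_overlap hu hxy hr ((hr.minPeriod_eq_iff q).1 hq)
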